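/- arXiv:1903.04973 — 4 statements merged into one kernel-verified Lean document; each statement's English description precedes it below -/
import Mathlib

section
/- Kirchhoff's matrix-tree theorem: Let G be a connected finite simple graph with vertex set {1,...,n} and Laplacian matrix L(G). For any vertices ℓ and m (not necessarily distinct), the number of spanning trees of G satisfies τ(G) = (-1)^{ℓ+m} · det(L(G)_{ℓ,m}), where L(G)_{ℓ,m} is the matrix obtained from L(G) by deleting the ℓ-th row and the m-th column. -/
/-- The number of spanning trees of a simple graph `G`: the number of subgraphs of `G`
that contain every vertex and are trees (connected and acyclic). -/
noncomputable def spanningTreeCount {V : Type*} (G : SimpleGraph V) : ℕ :=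
  Nat.card {T : G.Subgraph // T.IsSpanning ∧ T.coe.IsTree}

namespace MatrixTree

open Finset Matrix

variable {V : Type*} {r : V}

/-- The relation "`a` is the parent of `b`" defined by a parent function on the non-root
vertices. -/
def ParentRel (f : {v : V // v ≠ r} → V) (a b : V) : Prop :=
  ∃ h : b ≠ r, f ⟨b, h⟩ = a

/-- The graph with an edge joining each non-root vertex to its parent. -/
def parentGraph (f : {v : V // v ≠ r} → V) : SimpleGraph V :=
  SimpleGraph.fromEdgeSet (Set.range fun i ↦ s(i.1, f i))

/-- The matrix `1 - P`, where `P` is the adjacency matrix of the parent function restricted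
to the non-root vertices. -/
def parentMatrix [DecidableEq V] (R : Type*) [Ring R] (f : {v : V // v ≠ r} → V) :
    Matrix {v : V // v ≠ r} {v : V // v ≠ r} R :=
  Matrix.of fun i j ↦ (if i = j then 1 else 0) - if f i = j then 1 else 0

theorem parent_ne {f : {v : V // v ≠ r} → V} (hf : WellFounded (ParentRel f))
    (i : {v : V // v ≠ r}) : f i ≠ i := fun h ↦
  hf.irrefl.irrefl i.1 ⟨i.2, h⟩

theorem parentGraph_adj {f : {v : V // v ≠ r} → V} (hf : WellFounded (ParentRel f))
    (i : {v : V // v ≠ r}) : (parentGraph f).Adj i (f i) := by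
  rw [parentGraph, SimpleGraph.fromEdgeSet_adj]
  exact ⟨⟨i, rfl⟩, (parent_ne hf i).symm⟩

theorem parentGraph_le {f : {v : V // v ≠ r} → V} {G : SimpleGraph V}
    (h : ∀ i : {v : V // v ≠ r}, G.Adj i (f i)) : parentGraph f ≤ G := by
  rw [parentGraph, SimpleGraph.fromEdgeSet_le]
  rintro _ ⟨⟨i, rfl⟩, -⟩
  exact h i

theorem parentGraph_connected {f : {v : V // v ≠ r} → V} (hf : WellFounded (ParentRel f)) :
    (parentGraph f).Connected := by
  have key (v : V) : (parentGraph f).Reachable v r := by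
    induction v using hf.induction with
    | _ v ih =>
      by_cases h : v = r
      · rw [h]
      · exact (parentGraph_adj hf ⟨v, h⟩).reachable.trans (ih _ ⟨h, rfl⟩)
  have : Nonempty V := ⟨r⟩
  exact ⟨fun u v ↦ (key u).trans (key v).symm⟩

theorem parentGraph_isTree [Finite V] {f : {v : V // v ≠ r} → V}
    (hf : WellFounded (ParentRel f)) : (parentGraph f).IsTree := by
  classical
  have := Fintype.ofFinite V
  refine SimpleGraph.isTree_iff_connected_and_card.2 ⟨parentGraph_connected hf, ?_⟩
  refine le_antisymm ?_ (parentGraph_connected hf).card_vert_le_card_edgeSet_add_one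
  have h1 : Nat.card (parentGraph f).edgeSet ≤ Nat.card {v : V // v ≠ r} := by
    rw [parentGraph, SimpleGraph.edgeSet_fromEdgeSet]
    exact (Nat.card_mono (Set.toFinite _) Set.sdiff_subset).trans (Finite.card_range_le _)
  have h2 : Nat.card {v : V // v ≠ r} + 1 = Nat.card V := by
    have : 0 < Fintype.card V := Fintype.card_pos_iff.2 ⟨r⟩
    simp only [Nat.card_eq_fintype_card, ne_eq, Fintype.card_subtype_compl,
      Fintype.card_unique]
    omega
  omega

/-- In a graph containing all edges from vertices to their parents, each vertex has a path to
the root that starts by going to its parent. -/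
theorem exists_isPath_snd_eq_parent {f : {v : V // v ≠ r} → V}
    (hf : WellFounded (ParentRel f)) {G : SimpleGraph V}
    (hG : ∀ i : {v : V // v ≠ r}, G.Adj i (f i)) (v : V) :
    ∃ p : G.Walk v r, p.IsPath ∧ (∀ u ∈ p.support, (hf.apply u).rank ≤ (hf.apply v).rank) ∧
      ∀ h : v ≠ r, p.snd = f ⟨v, h⟩ := by
  induction v using hf.induction with
  | _ v ih =>
    by_cases h : v = r
    · subst h
      exact ⟨.nil, by simp, by simp, by simp⟩
    · obtain ⟨p, hp, hs, -⟩ := ih (f ⟨v, h⟩) ⟨h, rfl⟩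
      have hlt : (hf.apply (f ⟨v, h⟩)).rank < (hf.apply v).rank :=
        Acc.rank_lt_of_rel (hf.apply v) ⟨h, rfl⟩
      refine ⟨.cons (hG ⟨v, h⟩) p, ?_, ?_, fun _ ↦ by simp⟩
      · rw [SimpleGraph.Walk.cons_isPath_iff]
        exact ⟨hp, fun hv ↦ (hs v hv).not_gt hlt⟩
      · intro u hu
        rw [SimpleGraph.Walk.support_cons, List.mem_cons] at hu
        rcases hu with rfl | hu
        · rfl
        · exact (hs u hu).trans hlt.le

theorem parentGraph_injective {f g : {v : V // v ≠ r} → V} (hf : WellFounded (ParentRel f))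
    (hg : WellFounded (ParentRel g)) (hT : (parentGraph f).IsTree)
    (h : parentGraph f = parentGraph g) : f = g := by
  ext i
  obtain ⟨p, hp, -, hp'⟩ := exists_isPath_snd_eq_parent hf (parentGraph_adj hf) i
  obtain ⟨q, hq, -, hq'⟩ := exists_isPath_snd_eq_parent hg
    (G := parentGraph f) (fun j ↦ h ▸ parentGraph_adj hg j) i
  have : p = q := congrArg Subtype.val
    ((hT.isAcyclic.subsingleton_path i.1 r).elim ⟨p, hp⟩ ⟨q, hq⟩)
  rw [← hp' i.2, ← hq' i.2, this]

theorem exists_parentGraph_eq {T : SimpleGraph V} (hT : T.IsTree) (r : V) :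
    ∃ f : {v : V // v ≠ r} → V, WellFounded (ParentRel f) ∧ parentGraph f = T := by
  have key (i : {v : V // v ≠ r}) : ∃ w, T.Adj i w ∧ T.dist w r < T.dist i r := by
    obtain ⟨v, hv⟩ := i
    obtain ⟨p, hp⟩ := hT.connected.exists_walk_length_eq_dist v r
    cases p with
    | nil => exact absurd rfl hv
    | cons hadj q =>
      refine ⟨_, hadj, ?_⟩
      rw [← hp, SimpleGraph.Walk.length_cons]
      exact Nat.lt_succ_of_le (SimpleGraph.dist_le q)
  choose f hadj hlt using key
  have hwf : WellFounded (ParentRel f) := by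
    refine Subrelation.wf ?_ (measure fun v ↦ T.dist v r).wf
    rintro a b ⟨h, rfl⟩
    exact hlt ⟨b, h⟩
  refine ⟨f, hwf, le_antisymm (parentGraph_le hadj) ?_⟩
  exact (SimpleGraph.isTree_iff_minimal_connected.1 hT).2 (parentGraph_connected hwf)
    (parentGraph_le hadj)

theorem isTree_coe_iff {G : SimpleGraph V} {T : G.Subgraph} (h : T.IsSpanning) :
    T.coe.IsTree ↔ T.spanningCoe.IsTree :=
  (T.spanningCoeEquivCoeOfSpanning h).isTree_iff.symm

/-- Spanning trees correspond to parent functions along edges without directed cycles. -/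
theorem spanningTreeCount_eq_card_parent [Finite V] (G : SimpleGraph V) (r : V) :
    spanningTreeCount G = Nat.card {f : {v : V // v ≠ r} → V //
      (∀ i : {v : V // v ≠ r}, G.Adj i (f i)) ∧ WellFounded (ParentRel f)} := by
  refine (Nat.card_congr (Equiv.ofBijective (fun f ↦
    ⟨SimpleGraph.toSubgraph (parentGraph f.1) (parentGraph_le f.2.1),
      SimpleGraph.toSubgraph.isSpanning _ _,
      (isTree_coe_iff (SimpleGraph.toSubgraph.isSpanning _ _)).2 (parentGraph_isTree f.2.2)⟩)
    ⟨?_, ?_⟩)).symm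
  · rintro ⟨f, hf, hf'⟩ ⟨g, hg, hg'⟩ h
    have h' := congrArg (fun T ↦ T.1.spanningCoe) h
    exact Subtype.ext (parentGraph_injective hf' hg' (parentGraph_isTree hf') h')
  · rintro ⟨T, hT, hT'⟩
    obtain ⟨f, hf, hfT⟩ := exists_parentGraph_eq ((isTree_coe_iff hT).1 hT') r
    refine ⟨⟨f, fun i ↦ T.spanningCoe_le (hfT ▸ parentGraph_adj hf i), hf⟩, ?_⟩
    ext u v
    · simp [hT u]
    · change (parentGraph f).Adj u v ↔ _
      rw [hfT, SimpleGraph.Subgraph.spanningCoe_adj]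

variable [Fintype V] [DecidableEq V] {R : Type*} [CommRing R]

theorem det_parentMatrix_of_wellFounded {f : {v : V // v ≠ r} → V}
    (hf : WellFounded (ParentRel f)) : (parentMatrix R f).det = 1 := by
  classical
  let b (i : {v : V // v ≠ r}) := OrderDual.toDual (hf.apply i.1).rank
  have hlt (i j : {v : V // v ≠ r}) (h : f i = j) : b i < b j :=
    OrderDual.toDual_lt_toDual.2 (Acc.rank_lt_of_rel (hf.apply i.1) ⟨i.2, h⟩)
  have hb : (parentMatrix R f).BlockTriangular b := by
    intro i j hij
    rw [parentMatrix, of_apply, if_neg, if_neg, sub_zero]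
    · exact fun h ↦ hij.not_gt (hlt i j h)
    · rintro rfl
      exact hij.false
  rw [hb.det]
  refine prod_eq_one fun a _ ↦ ?_
  have hone : (parentMatrix R f).toSquareBlock b a = 1 := by
    ext ⟨i, hi⟩ ⟨j, hj⟩
    have : f i ≠ j := fun h ↦ (hlt i j h).ne (hi.trans hj.symm)
    simp [toSquareBlock_def, parentMatrix, this, one_apply]
  rw [hone, det_one]

theorem det_parentMatrix_of_not_wellFounded [IsDomain R] {f : {v : V // v ≠ r} → V}
    (hf : ¬ WellFounded (ParentRel f)) : (parentMatrix R f).det = 0 := by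
  classical
  have hr : Acc (ParentRel f) r := ⟨_, fun _ h ↦ (h.1 rfl).elim⟩
  have hacc (i : {v : V // v ≠ r}) : Acc (ParentRel f) i ↔ Acc (ParentRel f) (f i) :=
    ⟨fun h ↦ h.inv ⟨i.2, rfl⟩, fun h ↦ ⟨_, by rintro _ ⟨_, rfl⟩; exact h⟩⟩
  rw [← exists_mulVec_eq_zero_iff]
  refine ⟨fun i ↦ if Acc (ParentRel f) i then 0 else 1, fun h0 ↦ hf ⟨fun v ↦ ?_⟩, ?_⟩
  · by_contra hv
    have hvr : v ≠ r := fun h ↦ hv (h ▸ hr)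
    simpa [hv] using congrFun h0 ⟨v, hvr⟩
  · ext i
    simp only [mulVec, dotProduct, parentMatrix, of_apply, sub_mul, ite_mul, one_mul, zero_mul,
      sum_sub_distrib, sum_ite_eq, mem_univ, if_true, Pi.zero_apply]
    by_cases h : f i = r
    · have hj (j : {v : V // v ≠ r}) : f i ≠ j := fun hij ↦ j.2 (hij.symm.trans h)
      simp [hj, (hacc i).2 (by rwa [h])]
    · rw [sum_eq_single ⟨f i, h⟩, if_pos rfl]
      · simp [hacc i]
      · intro j _ hj
        rw [if_neg fun hij ↦ hj (Subtype.ext hij.symm)]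
      · simp

/-- The reduced Laplacian determinant counts the parent functions without directed cycles. -/
theorem det_lapMatrix_submatrix_ne [IsDomain R] (G : SimpleGraph V) [DecidableRel G.Adj] (r : V) :
    ((G.lapMatrix R).submatrix (Subtype.val : {v : V // v ≠ r} → V) Subtype.val).det =
      (spanningTreeCount G : R) := by
  classical
  have hrow : (G.lapMatrix R).submatrix (Subtype.val : {v : V // v ≠ r} → V) Subtype.val =
      fun i : {v : V // v ≠ r} ↦ ∑ w : V, fun j : {v : V // v ≠ r} ↦
        (if G.Adj i w then (if i = j then 1 else 0) - (if w = j then 1 else 0) else 0 : R) := by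
    ext i j
    rw [Finset.sum_apply, submatrix_apply, SimpleGraph.lapMatrix, Matrix.sub_apply,
      SimpleGraph.degMatrix, diagonal_apply, SimpleGraph.degree_eq_sum_if_adj,
      SimpleGraph.adjMatrix_apply]
    have (w : V) : (if G.Adj i w then (if i = j then 1 else 0) - (if w = j then 1 else 0)
        else 0 : R) = (if i = j then if G.Adj i w then 1 else 0 else 0) -
          if w = j then if G.Adj i w then 1 else 0 else 0 := by
      split_ifs <;> simp
    refine Eq.trans ?_ (sum_congr rfl fun w _ ↦ (this w).symm)
    rw [sum_sub_distrib, sum_ite_eq', if_pos (mem_univ _)]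
    simp only [Subtype.ext_iff]
    congr 1
    split_ifs <;> simp
  have hdet (f : {v : V // v ≠ r} → V) :
      (Matrix.of fun i j : {v : V // v ≠ r} ↦ (if G.Adj i (f i) then
        (if i = j then 1 else 0) - (if f i = j then 1 else 0) else 0 : R)).det =
      if (∀ i : {v : V // v ≠ r}, G.Adj i (f i)) ∧ WellFounded (ParentRel f) then 1 else 0 := by
    by_cases hadj : ∀ i : {v : V // v ≠ r}, G.Adj i (f i)
    · have : (Matrix.of fun i j : {v : V // v ≠ r} ↦ (if G.Adj i (f i) then
          (if i = j then 1 else 0) - (if f i = j then 1 else 0) else 0 : R)) =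
          parentMatrix R f := by
        ext i j
        simp [hadj i, parentMatrix]
      rw [this]
      by_cases hf : WellFounded (ParentRel f)
      · rw [det_parentMatrix_of_wellFounded hf, if_pos ⟨hadj, hf⟩]
      · rw [det_parentMatrix_of_not_wellFounded hf, if_neg fun h ↦ hf h.2]
    · rw [if_neg fun h ↦ hadj h.1]
      push Not at hadj
      obtain ⟨i, hi⟩ := hadj
      exact det_eq_zero_of_row_eq_zero i fun j ↦ by simp [hi]
  rw [hrow, spanningTreeCount_eq_card_parent G r, Nat.card_eq_fintype_card,
    Fintype.card_subtype, ← sum_boole]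
  refine ((detRowAlternating (R := R)).toMultilinearMap.map_sum _).trans ?_
  exact sum_congr rfl fun f _ ↦ hdet f

end MatrixTree

/-- Kirchhoff's matrix-tree theorem: for a connected graph `G` on the vertex set
`Fin (n + 1)` and any (not necessarily distinct) vertices `ℓ` and `m`, the number of
spanning trees of `G` equals `(-1) ^ (ℓ + m)` times the determinant of the reduced
Laplacian obtained by deleting row `ℓ` and column `m` from the Laplacian matrix. -/
theorem matrix_tree_theorem (n : ℕ) (G : SimpleGraph (Fin (n + 1)))
    [DecidableRel G.Adj] (hG : G.Connected) (ℓ m : Fin (n + 1)) :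
    (spanningTreeCount G : ℝ) =
      (-1 : ℝ) ^ ((ℓ : ℕ) + (m : ℕ)) *
        ((G.lapMatrix ℝ).submatrix ℓ.succAbove m.succAbove).det := by
  have hdiag : (spanningTreeCount G : ℝ) =
      ((G.lapMatrix ℝ).submatrix ℓ.succAbove ℓ.succAbove).det := by
    rw [← MatrixTree.det_lapMatrix_submatrix_ne G ℓ,
      ← Matrix.det_submatrix_equiv_self (finSuccAboveEquiv ℓ), Matrix.submatrix_submatrix]
    rfl
  have hsum (i : Fin n) : ∑ j, (G.lapMatrix ℝ).submatrix ℓ.succAbove id i j = 0 := by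
    simpa [Matrix.mulVec, dotProduct] using
      congrFun (G.lapMatrix_mulVec_const_eq_zero (R := ℝ)) (ℓ.succAbove i)
  have h := Matrix.submatrix_succAbove_det_eq_negOnePow_submatrix_succAbove_det'
    ((G.lapMatrix ℝ).submatrix ℓ.succAbove id) hsum ℓ m
  simp only [Matrix.submatrix_submatrix, Function.comp_id, Function.id_comp] at h
  rw [hdiag, h, Int.negOnePow_sub, ← Int.negOnePow_add, ← Nat.cast_add, Int.negOnePow_def]
  rw [zpow_natCast]
  simp [Units.smul_def]
end

section
/- Let G be a finite simple graph on vertex set V with Laplacian matrix L over ℝ. Then the adjugate of L equals τ(G) times the all-ones matrix, i.e., adj(L) = τ(G) · 1_V 1_Vᵀ, where τ(G) is the number of spanning trees of G. -/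
/-- A map `f` on the vertices is a parent map with root `r` if it fixes `r` and every vertex
is sent to `r` by some iterate of `f`. -/
structure IsParentMap {V : Type*} (r : V) (f : V → V) : Prop where
  map_root : f r = r
  exists_iterate_eq : ∀ v, ∃ k : ℕ, f^[k] v = r

/-- The graph joining each vertex to its image under `f`. -/
def parentGraph {V : Type*} (f : V → V) : SimpleGraph V :=
  SimpleGraph.fromRel fun v w => f v = w

namespace IsParentMap

variable {V : Type*} {r : V} {f g : V → V}

theorem induction (hf : IsParentMap r f) {P : V → Prop} (root : P r)
    (step : ∀ v, v ≠ r → P (f v) → P v) (v : V) : P v := by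
  obtain ⟨k, hk⟩ := hf.exists_iterate_eq v
  induction k generalizing v with
  | zero => exact (show v = r from hk) ▸ root
  | succ k ih =>
    by_cases hv : v = r
    · exact hv ▸ root
    · exact step v hv (ih (f v) hk)

theorem map_ne_self (hf : IsParentMap r f) {v : V} (hv : v ≠ r) : f v ≠ v := by
  intro h
  refine hf.induction (P := fun w => w ≠ v) hv.symm ?_ v rfl
  rintro w - hw rfl
  exact hw h

theorem map_map_ne_self (hf : IsParentMap r f) {v : V} (hv : v ≠ r) : f (f v) ≠ v := by
  intro h
  refine (hf.induction (P := fun w => w ≠ v ∧ w ≠ f v) ⟨hv.symm, ?_⟩ ?_ v).1 rfl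
  · intro hr
    rw [← hr, hf.map_root] at h
    exact hv h.symm
  · rintro w - ⟨h₁, h₂⟩
    exact ⟨fun hw => h₂ (hw ▸ rfl), fun hw => h₁ (hw ▸ h)⟩

theorem exists_depth (hf : IsParentMap r f) : ∃ d : V → ℕ, ∀ v, v ≠ r → d (f v) < d v := by
  classical
  refine ⟨fun v => Nat.find (hf.exists_iterate_eq v), fun v hv => ?_⟩
  have h := Nat.find_spec (hf.exists_iterate_eq v)
  have hpos : Nat.find (hf.exists_iterate_eq v) ≠ 0 := by
    intro h0
    rw [h0] at h
    exact hv h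
  obtain ⟨k, hk⟩ := Nat.exists_eq_succ_of_ne_zero hpos
  rw [hk] at h
  have := Nat.find_min' (hf.exists_iterate_eq (f v)) h
  simp only
  omega

theorem adj_map (hf : IsParentMap r f) {v : V} (hv : v ≠ r) : (parentGraph f).Adj v (f v) := by
  simpa [parentGraph] using (hf.map_ne_self hv).symm

theorem connected (hf : IsParentMap r f) : (parentGraph f).Connected := by
  have h : ∀ v, (parentGraph f).Reachable v r :=
    hf.induction (SimpleGraph.Reachable.refl _) fun v hv h => (hf.adj_map hv).reachable.trans h
  have : Nonempty V := ⟨r⟩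
  exact ⟨fun v w => (h v).trans (h w).symm⟩

theorem isTree [Finite V] (hf : IsParentMap r f) : (parentGraph f).IsTree := by
  classical
  have := Fintype.ofFinite V
  refine SimpleGraph.isTree_iff_connected_and_card.2 ⟨hf.connected, ?_⟩
  refine le_antisymm ?_ hf.connected.card_vert_le_card_edgeSet_add_one
  have hsub : (parentGraph f).edgeSet ⊆ Set.image (fun v => s(v, f v)) {r}ᶜ := by
    intro e
    induction e with | _ v w
    intro he
    obtain ⟨hne, h | h⟩ := (SimpleGraph.fromRel_adj _ _ _).1
      ((parentGraph f).mem_edgeSet.1 he)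
    · refine ⟨v, ?_, by simp [h]⟩
      rintro rfl
      exact hne (hf.map_root.symm.trans h)
    · refine ⟨w, ?_, by simp [h, Sym2.eq_swap]⟩
      rintro rfl
      exact hne (h.symm.trans hf.map_root)
  have h₁ := (Set.ncard_le_ncard hsub).trans (Set.ncard_image_le (Set.toFinite _))
  have h₂ := Set.ncard_add_ncard_compl ({r} : Set V)
  rw [Set.ncard_singleton] at h₂
  rw [Nat.card_coe_set_eq]
  omega

theorem eq_of_parentGraph_eq (hf : IsParentMap r f) (hg : IsParentMap r g)
    (h : parentGraph f = parentGraph g) : f = g := by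
  funext v
  refine hf.induction (P := fun v => f v = g v) (hf.map_root.trans hg.map_root.symm) ?_ v
  intro v hv hfv
  have hadj := hf.adj_map hv
  rw [h] at hadj
  obtain ⟨-, h | h⟩ := (SimpleGraph.fromRel_adj _ _ _).1 hadj
  · exact h.symm
  · exact absurd (hfv.trans h) (hf.map_map_ne_self hv)

theorem of_depth_lt (hr : f r = r) (d : V → ℕ) (h : ∀ v, v ≠ r → d (f v) < d v) :
    IsParentMap r f := by
  refine ⟨hr, fun v => ?_⟩
  induction hn : d v using Nat.strong_induction_on generalizing v with
  | _ n ih =>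
    by_cases hv : v = r
    · exact ⟨0, hv⟩
    · obtain ⟨k, hk⟩ := ih _ (hn ▸ h v hv) (f v) rfl
      exact ⟨k + 1, hk⟩

end IsParentMap

theorem SimpleGraph.IsTree.exists_isParentMap {V : Type*} {T : SimpleGraph V} (hT : T.IsTree)
    (r : V) : ∃ f, IsParentMap r f ∧ parentGraph f = T := by
  classical
  have hstep : ∀ v, v ≠ r → ∃ w, T.Adj v w ∧ T.dist w r < T.dist v r := by
    intro v hv
    obtain ⟨p, hp⟩ := hT.connected.exists_walk_length_eq_dist v r
    cases p with
    | nil => exact absurd rfl hv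
    | cons hadj q =>
      rw [Walk.length_cons] at hp
      exact ⟨_, hadj, by have := dist_le q; omega⟩
  choose! f hadj hlt using hstep
  have hf : IsParentMap r (Function.update f r r) := by
    refine .of_depth_lt (by simp) (fun v => T.dist v r) fun v hv => ?_
    simpa [hv] using hlt v hv
  have hle : parentGraph (Function.update f r r) ≤ T := by
    intro v w hvw
    have key : ∀ v w, v ≠ w → Function.update f r r v = w → T.Adj v w := by
      intro v w hne h
      by_cases hv : v = r
      · subst hv
        simp [hne] at h
      · rw [Function.update_of_ne hv] at h
        exact h ▸ hadj v hv
    obtain ⟨hne, h | h⟩ := (fromRel_adj _ _ _).1 hvw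
    · exact key v w hne h
    · exact (key w v hne.symm h).symm
  exact ⟨_, hf, le_antisymm hle ((isTree_iff_minimal_connected.1 hT).le_of_le hf.connected hle)⟩

theorem parentGraph_le_iff {V : Type*} {r : V} {f : V → V} {G : SimpleGraph V}
    (hf : IsParentMap r f) : parentGraph f ≤ G ↔ ∀ v, v ≠ r → G.Adj v (f v) := by
  refine ⟨fun h v hv => h (hf.adj_map hv), fun h v w hvw => ?_⟩
  have hroot : ∀ v w, v ≠ w → f v = w → v ≠ r := by
    rintro v w hne hvw rfl
    exact hne (hf.map_root.symm.trans hvw)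
  obtain ⟨hne, h' | h'⟩ := (SimpleGraph.fromRel_adj _ _ _).1 hvw
  · exact h' ▸ h v (hroot v w hne h')
  · exact (h' ▸ h w (hroot w v hne.symm h')).symm

/-- Spanning trees correspond to parent maps along edges, for every choice of the root. -/
theorem spanningTreeCount_eq_card_isParentMap {V : Type*} [Finite V] (G : SimpleGraph V) (r : V) :
    spanningTreeCount G =
      Nat.card {f : V → V // IsParentMap r f ∧ ∀ v, v ≠ r → G.Adj v (f v)} := by
  symm
  refine Nat.card_eq_of_bijective (fun f => ⟨SimpleGraph.toSubgraph (parentGraph f.1)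
    ((parentGraph_le_iff f.2.1).2 f.2.2), SimpleGraph.toSubgraph.isSpanning _ _, ?_⟩) ⟨?_, ?_⟩
  · exact (SimpleGraph.Iso.isTree_iff (SimpleGraph.Subgraph.spanningCoeEquivCoeOfSpanning _
      (SimpleGraph.toSubgraph.isSpanning _ _))).1 f.2.1.isTree
  · intro f g h
    refine Subtype.ext (f.2.1.eq_of_parentGraph_eq g.2.1 ?_)
    exact congrArg (fun T => T.1.spanningCoe) h
  · rintro ⟨T, hspan, hT⟩
    have hT' := (SimpleGraph.Iso.isTree_iff
      (SimpleGraph.Subgraph.spanningCoeEquivCoeOfSpanning T hspan)).2 hT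
    obtain ⟨f, hf, hfT⟩ := hT'.exists_isParentMap r
    refine ⟨⟨f, hf, (parentGraph_le_iff hf).1 (hfT ▸ T.spanningCoe_le)⟩, Subtype.ext ?_⟩
    refine SimpleGraph.Subgraph.ext ?_ ?_
    · exact hspan.verts_eq_univ.symm
    · exact congrArg SimpleGraph.Adj hfT

/-- The matrix with row `r` equal to `e_r` and every other row `v` equal to `e_v - e_{f v}`. -/
def parentMatrix {V : Type*} [DecidableEq V] (r : V) (f : V → V) : Matrix V V ℝ :=
  fun v => if v = r then Pi.single r 1 else Pi.single v 1 - Pi.single (f v) 1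

theorem det_parentMatrix_of_isParentMap {V : Type*} [Fintype V] [DecidableEq V] {r : V} {f : V → V}
    (hf : IsParentMap r f) : (parentMatrix r f).det = 1 := by
  obtain ⟨d, hd⟩ := hf.exists_depth
  have hzero : ∀ v w, v ≠ w → d v ≤ d w → parentMatrix r f v w = 0 := by
    intro v w hne hle
    by_cases hv : v = r
    · subst hv
      simp [parentMatrix, hne.symm]
    · have hw : w ≠ f v := by
        rintro rfl
        exact (hd v hv).not_ge hle
      simp [parentMatrix, hv, hne.symm, hw]
  have hone : ∀ v, parentMatrix r f v v = 1 := by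
    intro v
    by_cases hv : v = r
    · subst hv
      simp [parentMatrix]
    · simp [parentMatrix, hv, (hf.map_ne_self hv).symm]
  have htri : (parentMatrix r f).BlockTriangular (OrderDual.toDual ∘ d) := fun v w h =>
    hzero v w (by rintro rfl; exact lt_irrefl _ h) (le_of_lt h)
  rw [htri.det]
  refine Finset.prod_eq_one fun k _ => ?_
  convert Matrix.det_one (n := {v // (OrderDual.toDual ∘ d) v = k}) (R := ℝ)
  ext v w
  by_cases hvw : v = w
  · subst hvw
    simp [Matrix.toSquareBlock_def, hone]
  · rw [Matrix.one_apply_ne hvw]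
    exact hzero _ _ (fun h => hvw (Subtype.ext h))
      (le_of_eq (OrderDual.toDual.injective (v.2.trans w.2.symm)))

theorem det_parentMatrix_of_not_isParentMap {V : Type*} [Fintype V] [DecidableEq V] {r : V}
    {f : V → V} (hr : f r = r) (hf : ¬ IsParentMap r f) : (parentMatrix r f).det = 0 := by
  classical
  let x : V → ℝ := fun v => if ∃ k : ℕ, f^[k] v = r then 0 else 1
  have hxr : x r = 0 := if_pos ⟨0, rfl⟩
  have hxf : ∀ v, x (f v) = x v := by
    intro v
    have : (∃ k : ℕ, f^[k] (f v) = r) ↔ ∃ k : ℕ, f^[k] v = r := by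
      constructor
      · rintro ⟨k, hk⟩
        exact ⟨k + 1, hk⟩
      · rintro ⟨k, hk⟩
        refine ⟨k, ?_⟩
        rw [← Function.iterate_succ_apply, Function.iterate_succ_apply', hk, hr]
    simp only [x, this]
  refine Matrix.exists_mulVec_eq_zero_iff.1 ⟨x, ?_, ?_⟩
  · intro hx
    refine hf ⟨hr, fun v => ?_⟩
    by_contra hv
    have := congrFun hx v
    simp [x, hv] at this
  · funext v
    by_cases hv : v = r
    · simp [Matrix.mulVec, parentMatrix, hv, hxr]
    · change parentMatrix r f v ⬝ᵥ x = 0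
      simp only [parentMatrix, if_neg hv]
      rw [sub_dotProduct]
      simp [hxf]

theorem SimpleGraph.lapMatrix_row_eq_sum {V : Type*} [Fintype V] [DecidableEq V]
    (G : SimpleGraph V) [DecidableRel G.Adj] (v : V) :
    G.lapMatrix ℝ v =
      ∑ w ∈ G.neighborFinset v, (Pi.single v 1 - Pi.single w 1 : V → ℝ) := by
  funext u
  rw [Finset.sum_sub_distrib]
  simp [lapMatrix, degMatrix, Matrix.diagonal_apply, Pi.single_apply, adjMatrix_apply, eq_comm]

theorem SimpleGraph.adjugate_lapMatrix_diag {V : Type*} [Fintype V] [DecidableEq V]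
    (G : SimpleGraph V) [DecidableRel G.Adj] (r : V) :
    (G.lapMatrix ℝ).adjugate r r = spanningTreeCount G := by
  classical
  let A : V → Finset V := fun v => if v = r then {r} else G.neighborFinset v
  let g : V → V → V → ℝ := fun v w =>
    if v = r then Pi.single r 1 else Pi.single v 1 - Pi.single w 1
  have hrow : (G.lapMatrix ℝ).updateRow r (Pi.single r 1) = fun v => ∑ w ∈ A v, g v w := by
    funext v
    by_cases hv : v = r
    · subst hv
      simp [A, g]
    · simp [A, g, hv, Matrix.updateRow_ne, lapMatrix_row_eq_sum]
  have hA : ∀ f, f ∈ Fintype.piFinset A ↔ f r = r ∧ ∀ v, v ≠ r → G.Adj v (f v) := by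
    intro f
    rw [Fintype.mem_piFinset]
    constructor
    · intro h
      refine ⟨by simpa [A] using h r, fun v hv => by simpa [A, hv] using h v⟩
    · rintro ⟨h₁, h₂⟩ v
      by_cases hv : v = r
      · subst hv
        simp [A, h₁]
      · simpa [A, hv] using h₂ v hv
  have hexpand := (Matrix.detRowAlternating (n := V) (R := ℝ)).toMultilinearMap.map_sum_finset g A
  rw [Matrix.adjugate_apply, hrow]
  refine hexpand.trans ?_
  have hdet : ∀ f ∈ Fintype.piFinset A,
      (parentMatrix r f).det = if IsParentMap r f then 1 else 0 := by
    intro f hf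
    split_ifs with h
    · exact det_parentMatrix_of_isParentMap h
    · exact det_parentMatrix_of_not_isParentMap ((hA f).1 hf).1 h
  refine (Finset.sum_congr rfl hdet).trans ?_
  rw [Finset.sum_boole, spanningTreeCount_eq_card_isParentMap G r, Nat.card_eq_fintype_card,
    Fintype.card_subtype]
  congr 2
  ext f
  simp only [Finset.mem_filter, Finset.mem_univ, true_and, hA]
  exact ⟨fun h => ⟨h.2, h.1.2⟩, fun h => ⟨⟨h.1.map_root, h.2⟩, h.1⟩⟩

theorem SimpleGraph.adjugate_lapMatrix_apply_eq_diag {V : Type*} [Fintype V] [DecidableEq V]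
    (G : SimpleGraph V) [DecidableRel G.Adj] (i j : V) :
    (G.lapMatrix ℝ).adjugate i j = (G.lapMatrix ℝ).adjugate j j := by
  have h : ((G.lapMatrix ℝ).updateRow j (Pi.single i 1 - Pi.single j 1)).det = 0 := by
    refine Matrix.exists_mulVec_eq_zero_iff.1 ⟨fun _ => 1, ?_, ?_⟩
    · exact fun h => one_ne_zero (congrFun h j)
    · funext v
      by_cases hv : v = j
      · subst hv
        change Matrix.updateRow _ v _ v ⬝ᵥ (fun _ => (1 : ℝ)) = 0
        rw [Matrix.updateRow_self, sub_dotProduct]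
        simp
      · have := congrFun (G.lapMatrix_mulVec_const_eq_zero (R := ℝ)) v
        simpa [Matrix.mulVec, Matrix.updateRow_ne hv] using this
  have hadd := Matrix.det_updateRow_add (G.lapMatrix ℝ) j (Pi.single i 1 - Pi.single j 1)
    (Pi.single j 1)
  rw [sub_add_cancel, h, zero_add] at hadd
  rw [Matrix.adjugate_apply, Matrix.adjugate_apply, hadd]

/-- The adjugate of the Laplacian matrix of a finite simple graph `G` equals `τ(G)`
times the all-ones matrix. -/
theorem adjugate_lapMatrix {V : Type*} [Fintype V] [DecidableEq V]
    (G : SimpleGraph V) [DecidableRel G.Adj] :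
    (G.lapMatrix ℝ).adjugate =
      (spanningTreeCount G : ℝ) • Matrix.of fun _ _ => (1 : ℝ) := by
  ext i j
  simp [G.adjugate_lapMatrix_apply_eq_diag i j, G.adjugate_lapMatrix_diag j]
end

section
/- For all positive integers m and n, the number of spanning trees in the complete bipartite graph K_{m,n} is m^{n-1} · n^{m-1}, i.e., τ(K_{m,n}) = m^{n-1} n^{m-1}. -/
namespace SimpleGraph

open Finset Matrix

section ParentMap

variable {V : Type*} {r : V}

/-- The relation expressing that `a` is the parent of `b`, attached to a map `f` that assigns a
parent to every vertex other than the root `r`. -/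
def IsParent (f : {v : V // v ≠ r} → V) (a b : V) : Prop :=
  ∃ hb : b ≠ r, f ⟨b, hb⟩ = a

theorem ne_of_wellFounded_isParent {f : {v : V // v ≠ r} → V} (hf : WellFounded (IsParent f))
    (v : {v : V // v ≠ r}) : v.1 ≠ f v :=
  fun h => hf.irrefl.irrefl v.1 ⟨v.2, h.symm⟩

/-- The graph whose edges join every non-root vertex to its parent. -/
def parentGraph (f : {v : V // v ≠ r} → V) : SimpleGraph V :=
  SimpleGraph.fromRel (IsParent f)

theorem parentGraph_le {f : {v : V // v ≠ r} → V} {G : SimpleGraph V}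
    (hf : ∀ v : {v : V // v ≠ r}, G.Adj v (f v)) : parentGraph f ≤ G := by
  intro a b h
  obtain ⟨-, ⟨hb, rfl⟩ | ⟨ha, rfl⟩⟩ := (fromRel_adj _ _ _).1 h
  · exact (hf ⟨b, hb⟩).symm
  · exact hf ⟨a, ha⟩

theorem connected_parentGraph {f : {v : V // v ≠ r} → V} (hf : WellFounded (IsParent f)) :
    (parentGraph f).Connected := by
  have reach (v : V) : (parentGraph f).Reachable v r := by
    induction v using hf.induction with
    | _ v ih =>
      by_cases hv : v = r
      · rw [hv]
      · have hp : IsParent f (f ⟨v, hv⟩) v := ⟨hv, rfl⟩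
        exact Adj.reachable ((fromRel_adj _ _ _).2
          ⟨ne_of_wellFounded_isParent hf ⟨v, hv⟩, Or.inr hp⟩) |>.trans (ih _ hp)
  exact { preconnected := fun u v => (reach u).trans (reach v).symm, nonempty := ⟨r⟩ }

theorem isTree_parentGraph [Finite V] {f : {v : V // v ≠ r} → V}
    (hf : WellFounded (IsParent f)) : (parentGraph f).IsTree := by
  have hc := connected_parentGraph hf
  refine isTree_iff_connected_and_card.2 ⟨hc, le_antisymm ?_ hc.card_vert_le_card_edgeSet_add_one⟩
  have hsub : (parentGraph f).edgeSet ⊆ Set.range fun v : {v : V // v ≠ r} => s(v.1, f v) := by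
    intro e
    induction e with
    | _ a b =>
      rw [mem_edgeSet, parentGraph, fromRel_adj]
      rintro ⟨-, ⟨h, rfl⟩ | ⟨h, rfl⟩⟩
      · exact ⟨⟨b, h⟩, Sym2.eq_swap⟩
      · exact ⟨⟨a, h⟩, rfl⟩
  have hle : Nat.card (parentGraph f).edgeSet ≤ Nat.card {v : V // v ≠ r} :=
    (Nat.card_mono (Set.toFinite _) hsub).trans (Finite.card_range_le _)
  have hcard : Nat.card {v : V // v ≠ r} + 1 = Nat.card V := by
    classical
    have := Fintype.ofFinite V
    have : 0 < Fintype.card V := Fintype.card_pos_iff.2 ⟨r⟩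
    simp only [Nat.card_eq_fintype_card, Fintype.card_subtype_compl, Fintype.card_unique]
    omega
  omega

theorem parentGraph_injOn :
    Set.InjOn parentGraph {f : {v : V // v ≠ r} → V | WellFounded (IsParent f)} := by
  intro f (hf : WellFounded _) g _ hfg
  suffices ∀ v (hv : v ≠ r), f ⟨v, hv⟩ = g ⟨v, hv⟩ from funext fun v => this v.1 v.2
  intro v
  induction v using hf.induction with
  | _ v ih =>
    intro hv
    have hp : IsParent f (f ⟨v, hv⟩) v := ⟨hv, rfl⟩
    have hadj : (parentGraph f).Adj v (f ⟨v, hv⟩) :=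
      (fromRel_adj _ _ _).2 ⟨ne_of_wellFounded_isParent hf ⟨v, hv⟩, Or.inr hp⟩
    rw [hfg] at hadj
    obtain ⟨-, ⟨hw, hgw⟩ | ⟨_, hgv⟩⟩ := (fromRel_adj _ _ _).1 hadj
    · exact absurd hp (hf.asymmetric _ _ ⟨hw, (ih _ hp hw).trans hgw⟩)
    · exact hgv.symm

theorem IsTree.exists_parentGraph_eq {T : SimpleGraph V} (hT : T.IsTree) (r : V) :
    ∃ f : {v : V // v ≠ r} → V, (∀ v : {v : V // v ≠ r}, T.Adj v (f v)) ∧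
      WellFounded (IsParent f) ∧ parentGraph f = T := by
  have step (v : {v : V // v ≠ r}) : ∃ w, T.Adj v w ∧ T.dist w r < T.dist v r := by
    obtain ⟨v, hv⟩ := v
    obtain ⟨p, hp⟩ := hT.connected.exists_walk_length_eq_dist v r
    cases p with
    | nil => exact absurd rfl hv
    | cons h q =>
      refine ⟨_, h, ?_⟩
      have := dist_le q
      rw [Walk.length_cons] at hp
      change _ < T.dist v r
      omega
  choose f hadj hlt using step
  have hwf : WellFounded (IsParent f) :=
    Subrelation.wf (fun {a b} ⟨hb, h⟩ => h ▸ hlt ⟨b, hb⟩) (measure fun v => T.dist v r).wf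
  refine ⟨f, hadj, hwf, ?_⟩
  have hle : parentGraph f ≤ T := parentGraph_le hadj
  exact le_antisymm hle
    ((isTree_iff_minimal_connected.1 hT).le_of_le (connected_parentGraph hwf) hle)

open scoped Classical in
theorem det_parentMatrix [Fintype V] [DecidableEq V] {R : Type*} [CommRing R] [IsDomain R]
    (f : {v : V // v ≠ r} → V) :
    (Matrix.of fun v w : {v : V // v ≠ r} =>
      (if v = w then 1 else 0) - if f v = w then 1 else 0 : Matrix _ _ R).det =
      if WellFounded (IsParent f) then 1 else 0 := by
  split_ifs with hf
  · have : IsWellFounded V (IsParent f) := ⟨hf⟩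
    let b (v : {v : V // v ≠ r}) := OrderDual.toDual (IsWellFounded.rank (IsParent f) v.1)
    have hlt {v w : {v : V // v ≠ r}} (h : f v = w) : b v < b w :=
      IsWellFounded.rank_lt_of_rel (r := IsParent f) ⟨v.2, h⟩
    rw [BlockTriangular.det (b := b)]
    · refine prod_eq_one fun k _ => ?_
      refine (congrArg det ?_).trans det_one
      ext ⟨v, hv⟩ ⟨w, hw⟩
      have : f v ≠ w := fun h => (hlt h).ne (hv.trans hw.symm)
      simp [toSquareBlock, toSquareBlockProp, Matrix.one_apply, this]
    · intro v w hvw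
      have h₁ : v ≠ w := by rintro rfl; exact hvw.false
      have h₂ : f v ≠ w := fun h => hvw.not_gt (hlt h)
      simp [h₁, h₂]
  · rw [← exists_mulVec_eq_zero_iff]
    have hroot : Acc (IsParent f) r := ⟨_, fun _ ⟨h, _⟩ => absurd rfl h⟩
    have hiff (v : {v : V // v ≠ r}) : Acc (IsParent f) (f v) ↔ Acc (IsParent f) v :=
      ⟨fun h => ⟨_, fun _ ⟨_, e⟩ => e ▸ h⟩, fun h => h.inv ⟨v.2, rfl⟩⟩
    refine ⟨fun v => if Acc (IsParent f) v then 0 else 1, fun h0 => hf ⟨fun v => ?_⟩, ?_⟩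
    · by_contra hv
      have hvr : v ≠ r := fun h => hv (h ▸ hroot)
      simpa [hv] using congrFun h0 ⟨v, hvr⟩
    · ext v
      simp only [mulVec, dotProduct, of_apply, sub_mul, sum_sub_distrib, ite_mul, one_mul,
        zero_mul, sum_ite_eq, mem_univ, if_true, Pi.zero_apply]
      by_cases hfv : f v = r
      · have h₁ : ∀ w : {v : V // v ≠ r}, f v ≠ w := fun w h => w.2 (h.symm.trans hfv)
        have h₂ : Acc (IsParent f) v := (hiff v).1 (hfv.symm ▸ hroot)
        simp [h₁, h₂]
      · have h₁ : ∀ w : {v : V // v ≠ r}, f v = w ↔ (⟨f v, hfv⟩ : {v : V // v ≠ r}) = w :=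
          fun w => by rw [Subtype.ext_iff]
        simp [h₁, hiff]

end ParentMap

variable {V : Type*}

open scoped Classical in
theorem det_lapMatrix_submatrix [Fintype V] {R : Type*} [CommRing R] [IsDomain R]
    [DecidableEq V] (G : SimpleGraph V) [DecidableRel G.Adj] (r : V) :
    ((G.lapMatrix R).submatrix (Subtype.val : {v : V // v ≠ r} → V) Subtype.val).det =
      (#{f ∈ Fintype.piFinset fun v : {v : V // v ≠ r} => G.neighborFinset v |
        WellFounded (IsParent f)} : R) := by
  have hrow : (G.lapMatrix R).submatrix (Subtype.val : {v : V // v ≠ r} → V) Subtype.val =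
      fun v : {v : V // v ≠ r} => ∑ u ∈ G.neighborFinset v, fun w : {v : V // v ≠ r} =>
        ((if v = w then 1 else 0) - if u = w then 1 else 0 : R) := by
    ext v w
    simp [lapMatrix, degMatrix, diagonal_apply, adjMatrix_apply, Subtype.ext_iff,
      Finset.sum_apply, sum_sub_distrib]
  rw [hrow]
  refine (detRowAlternating (n := {v : V // v ≠ r}) (R := R)).toMultilinearMap.map_sum_finset
    (fun v u w => ((if v = w then 1 else 0) - if u = (w : V) then 1 else 0 : R))
    (fun v : {v : V // v ≠ r} => G.neighborFinset v) |>.trans ?_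
  rw [← sum_boole]
  exact sum_congr rfl fun f _ => det_parentMatrix f

open scoped Classical in
theorem card_isTree_le_eq [Fintype V] [DecidableEq V] (G : SimpleGraph V) [DecidableRel G.Adj]
    (r : V) :
    Nat.card {T : SimpleGraph V // T ≤ G ∧ T.IsTree} =
      #{f ∈ Fintype.piFinset fun v : {v : V // v ≠ r} => G.neighborFinset v |
        WellFounded (IsParent f)} := by
  have hset : {T : SimpleGraph V | T ≤ G ∧ T.IsTree} = parentGraph ''
      (({f ∈ Fintype.piFinset fun v : {v : V // v ≠ r} => G.neighborFinset v |
        WellFounded (IsParent f)} : Finset ({v : V // v ≠ r} → V)) :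
          Set ({v : V // v ≠ r} → V)) := by
    ext T
    simp only [Set.mem_ofPred_eq, coe_filter, Fintype.mem_piFinset, mem_neighborFinset,
      Set.mem_image]
    constructor
    · rintro ⟨hle, hT⟩
      obtain ⟨f, hadj, hwf, rfl⟩ := hT.exists_parentGraph_eq r
      exact ⟨f, ⟨fun v => hle (hadj v), hwf⟩, rfl⟩
    · rintro ⟨f, ⟨hadj, hwf⟩, rfl⟩
      exact ⟨parentGraph_le hadj, isTree_parentGraph hwf⟩
  change Nat.card {T : SimpleGraph V | T ≤ G ∧ T.IsTree} = _
  rw [hset, Nat.card_image_of_injOn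
      (parentGraph_injOn.mono fun f hf => by exact (mem_filter.1 (mem_coe.1 hf)).2),
    Nat.card_eq_card_toFinset, toFinset_coe]

/-- Spanning trees, regarded as subgraphs, correspond to trees on the same vertex type. -/
def spanningTreeEquiv (G : SimpleGraph V) :
    {T : G.Subgraph // T.IsSpanning ∧ T.coe.IsTree} ≃ {T : SimpleGraph V // T ≤ G ∧ T.IsTree} where
  toFun T := ⟨T.1.spanningCoe, T.1.spanningCoe_le,
    (T.1.spanningCoeEquivCoeOfSpanning T.2.1).isTree_iff.2 T.2.2⟩
  invFun T := ⟨toSubgraph T.1 T.2.1, toSubgraph.isSpanning _ _,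
    ((toSubgraph T.1 T.2.1).spanningCoeEquivCoeOfSpanning
      (toSubgraph.isSpanning _ _)).isTree_iff.1 T.2.2⟩
  left_inv T := Subtype.ext <| Subgraph.ext (T.2.1.verts_eq_univ.symm) rfl
  right_inv _ := rfl

/-- **Kirchhoff's matrix tree theorem**. -/
theorem spanningTreeCount_eq_det [Fintype V] {R : Type*} [CommRing R] [IsDomain R]
    [DecidableEq V] (G : SimpleGraph V) [DecidableRel G.Adj] (r : V) :
    (spanningTreeCount G : R) =
      ((G.lapMatrix R).submatrix (Subtype.val : {v : V // v ≠ r} → V) Subtype.val).det := by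
  rw [det_lapMatrix_submatrix, ← card_isTree_le_eq, spanningTreeCount,
    Nat.card_congr G.spanningTreeEquiv]

/-- Removing a vertex of the right part from a disjoint sum. -/
def sumNeInrEquiv {α β : Type*} (b : β) :
    α ⊕ {j : β // j ≠ b} ≃ {v : α ⊕ β // v ≠ Sum.inr b} where
  toFun := Sum.elim (fun i => ⟨Sum.inl i, by simp⟩) fun j => ⟨Sum.inr j.1, by simpa using j.2⟩
  invFun
    | ⟨Sum.inl i, _⟩ => Sum.inl i
    | ⟨Sum.inr j, h⟩ => Sum.inr ⟨j, by simpa using h⟩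
  left_inv := by rintro (i | j) <;> rfl
  right_inv := by rintro ⟨i | j, h⟩ <;> rfl

theorem det_fromBlocks_smul_one_neg_one {α β K : Type*} [Fintype α] [Fintype β] [DecidableEq α]
    [DecidableEq β] [Field K] {a b : K} (ha : a ≠ 0) (hb : b ≠ 0) :
    (fromBlocks (a • 1 : Matrix α α K) (of fun _ _ => -1) (of fun _ _ => -1)
      (b • 1 : Matrix β β K)).det =
      a ^ Fintype.card α *
        (b ^ Fintype.card β * (1 - Fintype.card α * Fintype.card β / (a * b))) := by
  have : Invertible (a • 1 : Matrix α α K) :=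
    ⟨a⁻¹ • 1, by simp [smul_smul, ha], by simp [smul_smul, ha]⟩
  have hinv : ⅟(a • 1 : Matrix α α K) = a⁻¹ • 1 := invOf_eq_right_inv (by simp [smul_smul, ha])
  have hschur : (b • 1 : Matrix β β K) -
      (of fun _ _ => -1 : Matrix β α K) * ⅟(a • 1 : Matrix α α K) *
        (of fun _ _ => -1 : Matrix α β K) =
      b • (1 + replicateCol Unit (fun _ : β => (-(Fintype.card α / (a * b)) : K)) *
        replicateRow Unit (fun _ : β => (1 : K))) := by
    rw [hinv]
    ext i j
    simp [Matrix.mul_apply, Matrix.one_apply]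
    field_simp
    split_ifs <;> ring
  rw [det_fromBlocks₁₁, hschur, det_smul, det_smul, det_one,
    det_one_add_replicateCol_mul_replicateRow]
  simp only [dotProduct, one_mul, mul_one, sum_const, card_univ, nsmul_eq_mul]
  ring

theorem lapMatrix_completeBipartiteGraph_submatrix {α β R : Type*} [Fintype α] [Fintype β]
    [DecidableEq α] [DecidableEq β] [DecidableRel (completeBipartiteGraph α β).Adj] [CommRing R]
    (b : β) :
    (((completeBipartiteGraph α β).lapMatrix R).submatrix
      (Subtype.val : {v : α ⊕ β // v ≠ Sum.inr b} → α ⊕ β) Subtype.val).submatrix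
        (sumNeInrEquiv b) (sumNeInrEquiv b) =
      fromBlocks ((Fintype.card β : R) • 1) (of fun _ _ => -1) (of fun _ _ => -1)
        ((Fintype.card α : R) • 1) := by
  ext (i | i) (j | j) <;>
  simp only [lapMatrix, degMatrix, submatrix_apply, Matrix.sub_apply, diagonal_apply,
    degree_eq_sum_if_adj, Fintype.sum_sum_type] <;>
  simp [sumNeInrEquiv, Matrix.one_apply, Subtype.ext_iff]

end SimpleGraph

/-- The number of spanning trees of the complete bipartite graph `K_{m,n}`
is `m ^ (n - 1) * n ^ (m - 1)`. -/
theorem spanningTreeCount_completeBipartiteGraph (m n : ℕ) (hm : 0 < m) (hn : 0 < n) :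
    spanningTreeCount (completeBipartiteGraph (Fin m) (Fin n)) =
      m ^ (n - 1) * n ^ (m - 1) := by
  classical
  obtain ⟨m, rfl⟩ := Nat.exists_eq_succ_of_ne_zero hm.ne'
  obtain ⟨n, rfl⟩ := Nat.exists_eq_succ_of_ne_zero hn.ne'
  have hm' : ((m.succ : ℕ) : ℚ) ≠ 0 := by positivity
  have hn' : ((n.succ : ℕ) : ℚ) ≠ 0 := by positivity
  have key := SimpleGraph.spanningTreeCount_eq_det (R := ℚ)
    (completeBipartiteGraph (Fin m.succ) (Fin n.succ)) (Sum.inr 0)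
  rw [← Matrix.det_submatrix_equiv_self (SimpleGraph.sumNeInrEquiv 0),
    SimpleGraph.lapMatrix_completeBipartiteGraph_submatrix,
    SimpleGraph.det_fromBlocks_smul_one_neg_one (by simpa using hn') (by simpa using hm')] at key
  have hcard : Fintype.card {j : Fin n.succ // j ≠ 0} = n := by
    simp [Fintype.card_subtype_compl]
  rw [hcard, Fintype.card_fin, Fintype.card_fin] at key
  rw [← Nat.cast_inj (R := ℚ), key]
  push_cast [Nat.succ_sub_one, Nat.succ_eq_add_one] at hm' hn' ⊢
  field_simp
  ring
end

section
/- Let G be a connected bipartite simple graph whose vertex set is partitioned as R ⊔ C with |R| = m and |C| = n, and suppose every vertex of C has positive degree. Then m·n·τ(G) = (∏_{c ∈ C} deg(c)) · det(S), where S is the m × m real matrix with rows and columns indexed by R whose entries are S(r,r) = deg(r) and, for r ≠ r', S(r,r') = Σ_{c ∈ N(r) \ N(r')} 1/deg(c), where N(v) denotes the set of neighbors of v. -/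
namespace SpanningTree

open Finset Matrix

variable {V : Type*}

/-- The map `f` fixes `root` and sends every vertex to `root` after finitely many iterations. -/
def Reaches (root : V) (f : V → V) : Prop :=
  f root = root ∧ ∀ v, ∃ k : ℕ, f^[k] v = root

lemma Reaches.exists_rank {root : V} {f : V → V} (hf : Reaches root f) :
    ∃ h : V → ℕ, ∀ v, v ≠ root → h (f v) < h v := by
  classical
  refine ⟨fun v => Nat.find (hf.2 v), fun v hv => ?_⟩
  change Nat.find (hf.2 (f v)) < Nat.find (hf.2 v)
  have hspec := Nat.find_spec (hf.2 v)
  rcases hk : Nat.find (hf.2 v) with _ | k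
  · rw [hk] at hspec
    exact absurd hspec hv
  · rw [hk, Function.iterate_succ_apply] at hspec
    exact Nat.lt_succ_of_le (Nat.find_min' (hf.2 (f v)) hspec)

lemma reaches_of_rank {root : V} {f : V → V} (hroot : f root = root) (h : V → ℕ)
    (hh : ∀ v, v ≠ root → h (f v) < h v) : Reaches root f := by
  refine ⟨hroot, fun v => ?_⟩
  induction hn : h v using Nat.strong_induction_on generalizing v with
  | _ n ih =>
    by_cases hv : v = root
    · exact ⟨0, hv⟩
    · obtain ⟨k, hk⟩ := ih _ (hn ▸ hh v hv) (f v) rfl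
      exact ⟨k + 1, hk⟩

/-- The graph joining every vertex to its image under `f`. -/
def parentGraph (f : V → V) : SimpleGraph V := SimpleGraph.fromRel fun v w => w = f v

lemma parentGraph_adj {f : V → V} {v w : V} :
    (parentGraph f).Adj v w ↔ v ≠ w ∧ (w = f v ∨ v = f w) := by
  simp [parentGraph]

lemma Reaches.ne {root : V} {f : V → V} (hf : Reaches root f) {v : V} (hv : v ≠ root) :
    v ≠ f v := by
  obtain ⟨h, hh⟩ := hf.exists_rank
  intro heq
  have := hh v hv
  rw [← heq] at this
  exact lt_irrefl _ this

lemma Reaches.parentGraph_connected {root : V} {f : V → V} (hf : Reaches root f) :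
    (parentGraph f).Connected := by
  have key : ∀ k v, f^[k] v = root → (parentGraph f).Reachable v root := by
    intro k
    induction k with
    | zero => rintro v rfl; exact SimpleGraph.Reachable.refl _
    | succ k ih =>
      intro v hv
      by_cases hvr : v = root
      · rw [hvr]
      · exact (parentGraph_adj.2 ⟨hf.ne hvr, Or.inl rfl⟩ :
          (parentGraph f).Adj v (f v)).reachable.trans (ih _ hv)
  have : Nonempty V := ⟨root⟩
  refine ⟨fun v w => ?_⟩
  obtain ⟨k, hk⟩ := hf.2 v
  obtain ⟨l, hl⟩ := hf.2 w
  exact (key k v hk).trans (key l w hl).symm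

lemma Reaches.parentGraph_isTree [Finite V] {root : V} {f : V → V} (hf : Reaches root f) :
    (parentGraph f).IsTree := by
  classical
  have := Fintype.ofFinite V
  refine SimpleGraph.isTree_iff_connected_and_card.2 ⟨hf.parentGraph_connected, ?_⟩
  refine le_antisymm ?_ hf.parentGraph_connected.card_vert_le_card_edgeSet_add_one
  have hsub : (parentGraph f).edgeSet ⊆
      ((univ.erase root).image fun v => s(v, f v) : Finset (Sym2 V)) := by
    intro e
    induction e with
    | _ v w =>
      rw [SimpleGraph.mem_edgeSet, parentGraph_adj]
      rintro ⟨hne, rfl | rfl⟩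
      · simp only [coe_image, coe_erase, coe_univ, Set.mem_image]
        refine ⟨v, ⟨trivial, ?_⟩, rfl⟩
        rintro rfl
        exact hne hf.1.symm
      · simp only [coe_image, coe_erase, coe_univ, Set.mem_image]
        refine ⟨w, ⟨trivial, ?_⟩, Sym2.eq_swap⟩
        rintro rfl
        exact hne hf.1
  have hcard : Nat.card (parentGraph f).edgeSet ≤ #(univ.erase root) := by
    rw [Nat.card_coe_set_eq]
    exact (Set.ncard_le_ncard hsub).trans ((Set.ncard_coe_finset _).trans_le card_image_le)
  rw [card_erase_of_mem (mem_univ _), card_univ, ← Nat.card_eq_fintype_card] at hcard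
  have : 0 < Nat.card V := Nat.card_pos_iff.2 ⟨⟨root⟩, inferInstance⟩
  omega

lemma Reaches.parentGraph_injective {root : V} {f g : V → V} (hf : Reaches root f)
    (hg : Reaches root g) (hfg : parentGraph f = parentGraph g) : f = g := by
  obtain ⟨h, hh⟩ := hf.exists_rank
  funext v
  induction hn : h v using Nat.strong_induction_on generalizing v with
  | _ n ih =>
    by_cases hv : v = root
    · rw [hv, hf.1, hg.1]
    · have hadj : (parentGraph g).Adj v (f v) :=
        hfg ▸ parentGraph_adj.2 ⟨hf.ne hv, Or.inl rfl⟩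
      rcases (parentGraph_adj.1 hadj).2 with h1 | h1
      · exact h1
      · have h2 := ih _ (hn ▸ hh v hv) (f v) rfl
        by_cases hfv : f v = root
        · rw [hfv, hg.1] at h1
          exact absurd h1 hv
        · have h3 := hh _ hfv
          have h4 := hh v hv
          rw [h2, ← h1] at h3
          omega

lemma exists_reaches_of_isTree {T : SimpleGraph V} (hT : T.IsTree) (root : V) :
    ∃ f : V → V, Reaches root f ∧ parentGraph f = T := by
  classical
  have hex : ∀ v, ∃ w, (v = root → w = root) ∧
      (v ≠ root → T.Adj v w ∧ T.dist w root < T.dist v root) := by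
    intro v
    by_cases hv : v = root
    · exact ⟨root, fun _ => rfl, fun h => absurd hv h⟩
    · obtain ⟨p, hp⟩ := hT.connected.exists_walk_length_eq_dist v root
      cases p with
      | nil => exact absurd rfl hv
      | cons hadj q =>
        refine ⟨_, fun h => absurd h hv, fun _ => ⟨hadj, ?_⟩⟩
        rw [← hp, SimpleGraph.Walk.length_cons]
        exact Nat.lt_succ_of_le (SimpleGraph.dist_le q)
  choose f hf0 hf1 using hex
  have hf : Reaches root f :=
    reaches_of_rank (hf0 root rfl) (T.dist · root) fun v hv => (hf1 v hv).2
  refine ⟨f, hf, ?_⟩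
  have hle : parentGraph f ≤ T := by
    intro v w hvw
    rcases parentGraph_adj.1 hvw with ⟨hne, rfl | rfl⟩
    · exact (hf1 v fun h => hne (by rw [h, hf.1])).1
    · exact (hf1 w fun h => hne (by rw [h, hf.1])).1.symm
  exact le_antisymm hle
    ((SimpleGraph.isTree_iff_minimal_connected.1 hT).2 hf.parentGraph_connected hle)

/-- Spanning trees correspond to trees on the vertex set contained in the graph. -/
lemma spanningTreeCount_eq (G : SimpleGraph V) :
    spanningTreeCount G = Nat.card {T : SimpleGraph V // T ≤ G ∧ T.IsTree} := by
  refine Nat.card_congr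
    { toFun := fun T => ⟨T.1.spanningCoe, T.1.spanningCoe_le,
        (T.1.spanningCoeEquivCoeOfSpanning T.2.1).isTree_iff.2 T.2.2⟩
      invFun := fun T => ⟨SimpleGraph.toSubgraph T.1 T.2.1,
        SimpleGraph.toSubgraph.isSpanning _ _, ?_⟩
      left_inv := ?_
      right_inv := ?_ }
  · refine (SimpleGraph.Subgraph.spanningCoeEquivCoeOfSpanning _
      (SimpleGraph.toSubgraph.isSpanning _ _)).isTree_iff.1 ?_
    exact T.2.2
  · rintro ⟨T, hT, -⟩
    apply Subtype.ext
    apply SimpleGraph.Subgraph.ext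
    · exact (SimpleGraph.Subgraph.isSpanning_iff.1 hT).symm
    · rfl
  · rintro ⟨T, -, -⟩
    rfl

/-- Spanning trees correspond to parent maps pointing towards a fixed root. -/
lemma spanningTreeCount_eq_card_reaches [Finite V] (G : SimpleGraph V) (root : V) :
    spanningTreeCount G =
      Nat.card {f : V → V // Reaches root f ∧ ∀ v, v ≠ root → G.Adj v (f v)} := by
  have hle : ∀ f : V → V, Reaches root f → (∀ v, v ≠ root → G.Adj v (f v)) →
      parentGraph f ≤ G := by
    intro f hf hadj v w hvw
    rcases parentGraph_adj.1 hvw with ⟨hne, rfl | rfl⟩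
    · exact hadj v fun h => hne (by rw [h, hf.1])
    · exact (hadj w fun h => hne (by rw [h, hf.1])).symm
  rw [spanningTreeCount_eq]
  refine (Nat.card_congr (Equiv.ofBijective
    (fun f : {f : V → V // Reaches root f ∧ ∀ v, v ≠ root → G.Adj v (f v)} =>
      (⟨parentGraph f.1, hle f.1 f.2.1 f.2.2, f.2.1.parentGraph_isTree⟩ :
        {T : SimpleGraph V // T ≤ G ∧ T.IsTree})) ⟨?_, ?_⟩)).symm
  · rintro ⟨f, hf, _⟩ ⟨g, hg, _⟩ hfg
    exact Subtype.ext (hf.parentGraph_injective hg (congrArg Subtype.val hfg))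
  · rintro ⟨T, hle, hT⟩
    obtain ⟨f, hf, rfl⟩ := exists_reaches_of_isTree hT root
    exact ⟨⟨f, hf, fun v hv => hle (parentGraph_adj.2 ⟨hf.ne hv, Or.inl rfl⟩)⟩, rfl⟩

variable [Fintype V] [DecidableEq V]

/-- A row of the matrix attached to a parent map. -/
def parentRow (root v w : V) : V → ℝ :=
  if v = root then Pi.single root 1 else Pi.single v 1 - Pi.single w 1

lemma det_parentRow_of_reaches {root : V} {f : V → V} (hf : Reaches root f) :
    (Matrix.of fun v => parentRow root v (f v)).det = 1 := by
  obtain ⟨h, hh⟩ := hf.exists_rank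
  have hM : ((Matrix.of fun v => parentRow root v (f v)) : Matrix V V ℝ).BlockTriangular
      (OrderDual.toDual ∘ h) := by
    intro i j hij
    have hij' : h i < h j := hij
    have hne : j ≠ i := by rintro rfl; exact lt_irrefl _ hij'
    by_cases hi : i = root
    · subst hi
      simp [parentRow, hne]
    · have hne' : j ≠ f i := by
        rintro rfl
        exact lt_asymm hij' (hh i hi)
      simp [parentRow, hi, hne, hne']
  rw [hM.det]
  refine Finset.prod_eq_one fun a _ => ?_
  rw [← Matrix.det_one (n := {i // (OrderDual.toDual ∘ h) i = a})]
  congr 1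
  ext ⟨i, hi⟩ ⟨j, hj⟩
  have hij : h i = h j := OrderDual.toDual.injective (hi.trans hj.symm)
  simp only [toSquareBlock_def, Matrix.of_apply, Matrix.one_apply, Subtype.mk.injEq]
  by_cases hir : i = root
  · subst hir
    simp [parentRow, Pi.single_apply, eq_comm]
  · have hne' : j ≠ f i := by
      rintro rfl
      exact (hh i hir).ne' hij
    simp [parentRow, hir, hne', Pi.single_apply, eq_comm]

lemma det_parentRow_of_not_reaches {root : V} {f : V → V} (hroot : f root = root)
    (hf : ¬ Reaches root f) : (Matrix.of fun v => parentRow root v (f v)).det = 0 := by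
  classical
  have hex : ∃ v, ∀ k : ℕ, f^[k] v ≠ root := by
    by_contra hcon
    push Not at hcon
    exact hf ⟨hroot, hcon⟩
  obtain ⟨v₀, hv₀⟩ := hex
  let x : V → ℝ := fun v => if ∀ k : ℕ, f^[k] v ≠ root then 1 else 0
  refine Matrix.exists_mulVec_eq_zero_iff.1 ⟨x, fun hx => ?_, ?_⟩
  · have := congrFun hx v₀
    simp [x, hv₀] at this
  · have hxroot : x root = 0 := by
      have : ¬ ∀ k : ℕ, f^[k] root ≠ root := fun h => h 0 rfl
      simp only [x, if_neg this]
    have hxf : ∀ v, v ≠ root → x (f v) = x v := by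
      intro v hv
      have : (∀ k : ℕ, f^[k] (f v) ≠ root) ↔ ∀ k : ℕ, f^[k] v ≠ root := by
        refine ⟨fun h k => ?_, fun h k => h (k + 1)⟩
        cases k with
        | zero => exact hv
        | succ k => exact h k
      simp only [x, this]
    funext v
    by_cases hv : v = root
    · subst hv
      simp [Matrix.mulVec, parentRow, hxroot]
    · have hsub : (Pi.single v 1 - Pi.single (f v) 1 : V → ℝ) ⬝ᵥ x = 0 := by
        simp [sub_dotProduct, hxf v hv]
      simpa only [Matrix.mulVec, parentRow, Matrix.of_apply, if_neg hv, Pi.zero_apply] using hsub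

variable (G : SimpleGraph V) [DecidableRel G.Adj]

lemma lapMatrix_row (v : V) :
    G.lapMatrix ℝ v = ∑ w ∈ G.neighborFinset v, (Pi.single v 1 - Pi.single w 1 : V → ℝ) := by
  funext u
  simp only [Finset.sum_apply, Pi.sub_apply, Finset.sum_sub_distrib, SimpleGraph.lapMatrix,
    Matrix.sub_apply, SimpleGraph.degMatrix, Matrix.diagonal_apply, SimpleGraph.adjMatrix_apply,
    Pi.single_apply, Finset.sum_const, SimpleGraph.card_neighborFinset_eq_degree,
    eq_comm (a := u)]
  simp

/-- **Kirchhoff's matrix tree theorem**. -/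
theorem det_updateRow_lapMatrix (root : V) :
    ((G.lapMatrix ℝ).updateRow root (Pi.single root 1)).det = spanningTreeCount G := by
  classical
  let t : V → Finset V := fun v => if v = root then {root} else G.neighborFinset v
  have hrows : (G.lapMatrix ℝ).updateRow root (Pi.single root 1) =
      fun v => ∑ w ∈ t v, parentRow root v w := by
    funext v
    by_cases hv : v = root
    · subst hv
      simp [t, parentRow]
    · rw [Matrix.updateRow_ne hv, lapMatrix_row]
      simp [t, parentRow, hv]
  have hexp := (detRowAlternating : (V → ℝ) [⋀^V]→ₗ[ℝ] ℝ).toMultilinearMap.map_sum_finset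
    (fun v w => parentRow root v w) t
  rw [hrows]
  refine hexp.trans ?_
  have hterm : ∀ f ∈ Fintype.piFinset t,
      (Matrix.of fun v => parentRow root v (f v)).det = if Reaches root f then 1 else 0 := by
    intro f hf
    have hroot : f root = root := by
      simpa [t] using Fintype.mem_piFinset.1 hf root
    split_ifs with h
    · exact det_parentRow_of_reaches h
    · exact det_parentRow_of_not_reaches hroot h
  refine (Finset.sum_congr rfl hterm).trans ?_
  rw [Finset.sum_boole, spanningTreeCount_eq_card_reaches G root]
  congr 1
  rw [Nat.card_eq_fintype_card, Fintype.card_subtype]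
  congr 1
  ext f
  simp only [mem_filter, Fintype.mem_piFinset, mem_univ, true_and, t]
  constructor
  · rintro ⟨hf, hr⟩
    exact ⟨hr, fun v hv => by simpa [hv] using hf v⟩
  · rintro ⟨hr, hf⟩
    refine ⟨fun v => ?_, hr⟩
    by_cases hv : v = root
    · simp [hv, hr.1]
    · simpa [hv] using hf v hv

lemma det_updateRow_lapMatrix_eq_sum_mul (root : V) (b : V → ℝ) :
    ((G.lapMatrix ℝ).updateRow root b).det = (∑ v, b v) * spanningTreeCount G := by
  have hb : b = (∑ v, b v) • Pi.single root 1 + (b - (∑ v, b v) • Pi.single root 1) := by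
    abel
  have hzero : ((G.lapMatrix ℝ).updateRow root (b - (∑ v, b v) • Pi.single root 1)).det = 0 := by
    refine Matrix.exists_mulVec_eq_zero_iff.1 ⟨fun _ => 1, fun h => ?_, ?_⟩
    · exact one_ne_zero (congrFun h root)
    · funext v
      by_cases hv : v = root
      · subst hv
        simp [Matrix.mulVec, dotProduct, Pi.single_apply, Finset.sum_sub_distrib]
      · have := congrFun (G.lapMatrix_mulVec_const_eq_zero (R := ℝ)) v
        simpa [Matrix.mulVec, Matrix.updateRow_ne hv] using this
  rw [hb, Matrix.det_updateRow_add, hzero, add_zero, Matrix.det_updateRow_smul,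
    det_updateRow_lapMatrix, ← hb]

/-- A rank-one perturbation of the Laplacian counts spanning trees. -/
lemma det_lapMatrix_add_vecMulVec [Nonempty V] (a b : V → ℝ) :
    (G.lapMatrix ℝ + vecMulVec a b).det = (∑ v, a v) * (∑ v, b v) * spanningTreeCount G := by
  obtain ⟨root⟩ := ‹Nonempty V›
  have hsum : ∑ k, (1 : ℝ) • (G.lapMatrix ℝ + vecMulVec a b) k = (∑ v, a v) • b := by
    funext w
    have hcol : ∑ k, G.lapMatrix ℝ k w = 0 := by
      have := congrFun (G.lapMatrix_mulVec_const_eq_zero (R := ℝ)) w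
      refine Eq.trans ?_ this
      simp only [Matrix.mulVec, dotProduct, mul_one]
      exact Finset.sum_congr rfl fun k _ => (G.isSymm_lapMatrix (R := ℝ)).apply w k
    have hentry : ∀ k, ((1 : ℝ) • (G.lapMatrix ℝ + vecMulVec a b) k) w =
        G.lapMatrix ℝ k w + a k * b w := fun k => one_mul _
    rw [Finset.sum_apply, Finset.sum_congr rfl fun k _ => hentry k, Finset.sum_add_distrib, hcol,
      zero_add, ← Finset.sum_mul]
    rfl
  have h1 := Matrix.det_updateRow_sum (G.lapMatrix ℝ + vecMulVec a b) root (fun _ => 1)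
  rw [hsum, one_smul, Matrix.det_updateRow_smul] at h1
  have h2 : ((G.lapMatrix ℝ + vecMulVec a b).updateRow root b).det =
      ((G.lapMatrix ℝ).updateRow root b).det := by
    refine Matrix.det_eq_of_forall_row_eq_smul_add_const
      (fun v => if v = root then 0 else a v) root (by simp) fun i j => ?_
    by_cases hi : i = root
    · subst hi
      simp
    · simp [hi, vecMulVec_apply]
  rw [← h1, h2, det_updateRow_lapMatrix_eq_sum_mul, mul_assoc]

end SpanningTree

/-- For a connected bipartite graph `G` on `R ⊔ C` (all edges between the parts) in
which every vertex of `C` has positive degree,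
`|R| |C| τ(G) = (∏_{c ∈ C} deg c) · det S`, where `S` is the `R × R` matrix with
`S r r = deg r` and, for `r ≠ r'`, `S r r' = ∑_{c ∈ N(r) \ N(r')} 1 / deg c`. -/
theorem bipartite_schur_spanning_tree_count {R C : Type*} [Fintype R] [Fintype C]
    [DecidableEq R] (G : SimpleGraph (R ⊕ C)) [DecidableRel G.Adj]
    (hbipR : ∀ a b : R, ¬ G.Adj (Sum.inl a) (Sum.inl b))
    (hbipC : ∀ a b : C, ¬ G.Adj (Sum.inr a) (Sum.inr b))
    (hconn : G.Connected)
    (hdeg : ∀ c : C, 0 < G.degree (Sum.inr c)) :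
    (Fintype.card R : ℝ) * (Fintype.card C : ℝ) * (spanningTreeCount G : ℝ) =
      (∏ c : C, (G.degree (Sum.inr c) : ℝ)) *
        (Matrix.of fun r r' : R =>
          if r = r' then (G.degree (Sum.inl r) : ℝ)
          else ∑ c ∈ Finset.univ.filter
              (fun c : C => G.Adj (Sum.inl r) (Sum.inr c) ∧
                ¬ G.Adj (Sum.inl r') (Sum.inr c)),
            1 / (G.degree (Sum.inr c) : ℝ)).det := by
  classical
  let a : R ⊕ C → ℝ := Sum.elim (fun _ => 0) fun _ => 1
  let b : R ⊕ C → ℝ := Sum.elim (fun _ => 1) fun _ => 0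
  have : Nonempty (R ⊕ C) := hconn.nonempty
  have hrank := SpanningTree.det_lapMatrix_add_vecMulVec G a b
  let D : Matrix C C ℝ := Matrix.diagonal fun c => (G.degree (Sum.inr c) : ℝ)
  let E : Matrix C C ℝ := Matrix.diagonal fun c => (G.degree (Sum.inr c) : ℝ)⁻¹
  have hne : ∀ c : C, (G.degree (Sum.inr c) : ℝ) ≠ 0 :=
    fun c => Nat.cast_ne_zero.2 (hdeg c).ne'
  let _ : Invertible D := ⟨E, by simp [D, E, hne], by simp [D, E, hne]⟩
  have hinv : ⅟D = E := rfl
  have hblocks : G.lapMatrix ℝ + Matrix.vecMulVec a b = Matrix.fromBlocks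
      (Matrix.diagonal fun r => (G.degree (Sum.inl r) : ℝ))
      (Matrix.of fun r c => if G.Adj (Sum.inl r) (Sum.inr c) then -1 else 0)
      (Matrix.of fun c r => if G.Adj (Sum.inl r) (Sum.inr c) then 0 else 1) D := by
    have hentry : ∀ i j, (G.lapMatrix ℝ + Matrix.vecMulVec a b) i j =
        (if i = j then (G.degree i : ℝ) else 0) - (if G.Adj i j then 1 else 0) + a i * b j :=
      fun _ _ => rfl
    ext (r | c) (r' | c')
    · simp [hentry, a, b, hbipR, Matrix.diagonal_apply]
    · by_cases h : G.Adj (Sum.inl r) (Sum.inr c') <;> simp [hentry, a, b, h]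
    · by_cases h : G.Adj (Sum.inl r') (Sum.inr c) <;>
        simp [hentry, a, b, G.adj_comm (Sum.inr c), h]
    · simp [hentry, a, b, hbipC, Matrix.diagonal_apply, D]
  rw [hblocks, Matrix.det_fromBlocks₂₂, hinv, Matrix.det_diagonal] at hrank
  have hsa : ∑ v, a v = Fintype.card C := by simp [a]
  have hsb : ∑ v, b v = Fintype.card R := by simp [b]
  rw [hsa, hsb] at hrank
  rw [mul_comm (Fintype.card R : ℝ), ← hrank]
  congr 2
  ext r r'
  rw [Matrix.sub_apply, Matrix.mul_apply]
  simp only [E, Matrix.mul_diagonal, Matrix.of_apply, Matrix.diagonal_apply]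
  by_cases hr : r = r'
  · subst hr
    simp only [if_true]
    rw [sub_eq_self]
    refine Finset.sum_eq_zero fun c _ => ?_
    split_ifs <;> simp
  · simp only [hr, if_false, zero_sub, Finset.sum_filter, ← Finset.sum_neg_distrib]
    refine Finset.sum_congr rfl fun c _ => ?_
    by_cases h1 : G.Adj (Sum.inl r) (Sum.inr c) <;>
      by_cases h2 : G.Adj (Sum.inl r') (Sum.inr c) <;> simp [h1, h2]
end
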